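/- Let V and Ṽ be closed cones in ℝ^k with V \ {0} ⊆ int Ṽ, and let r, s ∈ ℝ. Then there exists C > 0 such that for all measurable functions g, h : ℝ^k → [0,∞] one has (∫_V ⟨x⟩^{2r} (∫_{ℝ^k} g(y) h(x−y) dy)² dx)^{1/2} ≤ C · (∫_{ℝ^k} ⟨y⟩^{3|r|+2|s|} g(y) dy) · ( (∫_{Ṽ} ⟨z⟩^{2r} h(z)² dz)^{1/2} + (∫_{ℝ^k} ⟨z⟩^{2s} h(z)² dz)^{1/2} ), where all integrals are Lebesgue integrals with values in [0,∞]. -/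

import Mathlib

open scoped ENNReal
open MeasureTheory

/-- A cone in a real vector space: closed under multiplication by positive scalars. -/
def IsConeSet {E : Type*} [SMul ℝ E] (V : Set E) : Prop :=
  ∀ ⦃x⦄, x ∈ V → ∀ ⦃lam : ℝ⦄, 0 < lam → lam • x ∈ V

/-- The Japanese bracket `⟨x⟩ = (1 + |x|²)^(1/2)`. -/
noncomputable def jb {E : Type*} [NormedAddCommGroup E] (x : E) : ℝ :=
  Real.sqrt (1 + ‖x‖ ^ 2)

section JapaneseBracket

variable {E : Type*} [NormedAddCommGroup E]

theorem one_le_jb (x : E) : 1 ≤ jb x := by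
  rw [jb, Real.one_le_sqrt]
  nlinarith [sq_nonneg ‖x‖]

theorem norm_le_jb (x : E) : ‖x‖ ≤ jb x :=
  Real.le_sqrt_of_sq_le (by linarith)

theorem jb_le_one_add_norm (x : E) : jb x ≤ 1 + ‖x‖ :=
  Real.sqrt_le_iff.2 ⟨by positivity, by nlinarith [norm_nonneg x]⟩

theorem continuous_jb : Continuous (jb : E → ℝ) := by
  unfold jb
  fun_prop

/-- Peetre's inequality. -/
theorem jb_add_le (x y : E) : jb (x + y) ≤ 2 * jb x * jb y := by
  have hx := one_le_jb x
  have hy := one_le_jb y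
  have h : jb (x + y) ^ 2 ≤ (2 * jb x * jb y) ^ 2 := by
    have h1 := norm_add_le x y
    have h2 : ‖x + y‖ ^ 2 ≤ (‖x‖ + ‖y‖) ^ 2 := by gcongr
    have e (z : E) : jb z ^ 2 = 1 + ‖z‖ ^ 2 := Real.sq_sqrt (by positivity)
    rw [mul_pow, mul_pow, e, e, e]
    nlinarith [sq_nonneg (‖x‖ - ‖y‖), mul_nonneg (sq_nonneg ‖x‖) (sq_nonneg ‖y‖),
      sq_nonneg ‖x‖, sq_nonneg ‖y‖]
  exact le_of_sq_le_sq h (by positivity)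

end JapaneseBracket

theorem Real.rpow_le_rpow_abs_mul_rpow {a b B : ℝ} (ha : 0 < a) (hb : 0 < b) (hB : 0 < B)
    (hab : a ≤ B * b) (hba : b ≤ B * a) (t : ℝ) : a ^ t ≤ B ^ |t| * b ^ t := by
  rcases le_total 0 t with ht | ht
  · rw [abs_of_nonneg ht, ← Real.mul_rpow hB.le hb.le]
    exact Real.rpow_le_rpow ha.le hab ht
  · have h : b / B ≤ a := by rwa [div_le_iff₀' hB]
    rw [abs_of_nonpos ht, Real.rpow_neg hB.le, inv_mul_eq_div, ← Real.div_rpow hb.le hB.le]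
    exact Real.rpow_le_rpow_of_nonpos (by positivity) h ht

/-- Points of a closed cone keep a distance proportional to their norm from the complement of a
larger cone. -/
theorem IsConeSet.exists_mul_norm_le_norm_sub {E : Type*} [NormedAddCommGroup E]
    [NormedSpace ℝ E] [ProperSpace E] {V W : Set E} (hVcl : IsClosed V) (hV : IsConeSet V)
    (hW : IsConeSet W) (hsub : V \ {0} ⊆ interior W) :
    ∃ c : ℝ, 0 < c ∧ ∀ x ∈ V, ∀ z ∉ W, c * ‖x‖ ≤ ‖x - z‖ := by
  have hK : IsCompact (V ∩ Metric.sphere 0 1) := (isCompact_sphere 0 1).inter_left hVcl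
  have hKW : V ∩ Metric.sphere 0 1 ⊆ interior W := fun x hx =>
    hsub ⟨hx.1, by rintro rfl; simpa using hx.2⟩
  obtain ⟨c, hc, hcW⟩ := hK.exists_thickening_subset_open isOpen_interior hKW
  refine ⟨c, hc, fun x hx z hz => ?_⟩
  rcases eq_or_ne x 0 with rfl | hx0
  · simp
  have hn : 0 < ‖x‖ := norm_pos_iff.2 hx0
  by_contra! hlt
  have hmem : ‖x‖⁻¹ • z ∈ W := interior_subset <| hcW <| Metric.mem_thickening_iff.2
    ⟨‖x‖⁻¹ • x, ⟨hV hx (inv_pos.2 hn), by simp [norm_smul, hn.ne']⟩, by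
      rw [dist_comm, dist_eq_norm, ← smul_sub, norm_smul, norm_inv, norm_norm,
        inv_mul_lt_iff₀ hn]
      linarith⟩
  exact hz (by simpa [smul_smul, hn.ne'] using hW hmem hn)

theorem exists_jb_rpow_le {E : Type*} [NormedAddCommGroup E]
    [NormedSpace ℝ E] [ProperSpace E] {V W : Set E} (hVcl : IsClosed V) (hV : IsConeSet V)
    (hW : IsConeSet W) (hsub : V \ {0} ⊆ interior W) (r s : ℝ) :
    ∃ C : ℝ, 0 < C ∧ ∀ x ∈ V, ∀ y,
      (x - y ∈ W → jb x ^ r ≤ C * jb y ^ (3 * |r| + 2 * |s|) * jb (x - y) ^ r) ∧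
      (x - y ∉ W → jb x ^ r ≤ C * jb y ^ (3 * |r| + 2 * |s|) * jb (x - y) ^ s) := by
  obtain ⟨c, hc, hcW⟩ := hV.exists_mul_norm_le_norm_sub hVcl hW hsub
  have hM : 0 < 2 + c⁻¹ := by positivity
  have hM1 : 1 ≤ 2 + c⁻¹ := by linarith [inv_pos.2 hc]
  refine ⟨(2 + c⁻¹) ^ (|r| + |s|), by positivity, fun x hx y => ?_⟩
  have hx1 := one_le_jb x
  have hy1 := one_le_jb y
  have hz1 := one_le_jb (x - y)
  have hB1 : 1 ≤ (2 + c⁻¹) * jb y := by nlinarith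
  have hBpow : ((2 + c⁻¹) * jb y) ^ (|r| + |s|) ≤
      (2 + c⁻¹) ^ (|r| + |s|) * jb y ^ (3 * |r| + 2 * |s|) := by
    rw [Real.mul_rpow hM.le (by linarith)]
    gcongr
    · linarith [abs_nonneg r]
    · linarith [abs_nonneg s]
  set B := (2 + c⁻¹) * jb y with hB
  have hB2 : 2 * jb y ≤ B := by rw [hB]; gcongr; linarith [inv_pos.2 hc]
  constructor
  · intro _
    have h1 : jb x ≤ B * jb (x - y) := by
      have := jb_add_le y (x - y)
      rw [add_sub_cancel] at this
      exact this.trans (by gcongr)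
    have h2 : jb (x - y) ≤ B * jb x := by
      have := jb_add_le (-y) x
      rw [neg_add_eq_sub] at this
      refine this.trans ?_
      rw [show jb (-y) = jb y by simp [jb]]
      gcongr
    calc jb x ^ r ≤ B ^ |r| * jb (x - y) ^ r :=
          Real.rpow_le_rpow_abs_mul_rpow (by linarith) (by linarith) (by linarith) h1 h2 r
      _ ≤ B ^ (|r| + |s|) * jb (x - y) ^ r := by
          gcongr
          linarith [abs_nonneg s]
      _ ≤ _ := by gcongr
  · intro hz
    have hxy : ‖x‖ ≤ c⁻¹ * jb y := by
      have h := hcW x hx _ hz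
      rw [sub_sub_cancel] at h
      rw [le_inv_mul_iff₀ hc]
      exact h.trans (norm_le_jb y)
    have h1 : jb x ≤ B := by
      have := jb_le_one_add_norm x
      rw [hB]; linarith
    have h2 : jb (x - y) ≤ B := by
      have := jb_le_one_add_norm (x - y)
      have := norm_sub_le x y
      have := norm_le_jb y
      rw [hB]; linarith
    have h3 := Real.rpow_le_rpow_abs_mul_rpow (a := jb x) (b := 1) (B := B)
      (by linarith) one_pos (by linarith) (by linarith) (by nlinarith) r
    have h4 := Real.rpow_le_rpow_abs_mul_rpow (a := 1) (b := jb (x - y)) (B := B)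
      one_pos (by linarith) (by linarith) (by nlinarith) (by linarith) s
    rw [Real.one_rpow] at h3 h4
    calc jb x ^ r ≤ B ^ |r| * 1 := h3
      _ ≤ B ^ |r| * (B ^ |s| * jb (x - y) ^ s) := by gcongr
      _ = B ^ (|r| + |s|) * jb (x - y) ^ s := by
          rw [Real.rpow_add (by linarith)]; ring
      _ ≤ _ := by gcongr

/-- Cauchy–Schwarz for the measure with density `f`. -/
theorem lintegral_mul_sq_le {α : Type*} [MeasurableSpace α] {μ : Measure α} {f u : α → ℝ≥0∞}
    (hf : AEMeasurable f μ) (hu : AEMeasurable u μ) :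
    (∫⁻ y, f y * u y ∂μ) ^ 2 ≤ (∫⁻ y, f y ∂μ) * ∫⁻ y, f y * u y ^ 2 ∂μ := by
  have hsq (a : ℝ≥0∞) : (a ^ (1 / 2 : ℝ)) ^ 2 = a := by
    rw [← ENNReal.rpow_mul_natCast]; norm_num
  have h := ENNReal.lintegral_mul_le_Lp_mul_Lq μ Real.HolderConjugate.two_two
    (hf.pow_const (1 / 2 : ℝ)) ((hf.pow_const (1 / 2 : ℝ)).mul hu)
  simp only [Pi.mul_apply, ENNReal.rpow_two, mul_pow, hsq, ← mul_assoc, ← pow_two] at h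
  calc _ ≤ ((∫⁻ y, f y ∂μ) ^ (1 / 2 : ℝ) * (∫⁻ y, f y * u y ^ 2 ∂μ) ^ (1 / 2 : ℝ)) ^ 2 := by
        gcongr
    _ = _ := by rw [mul_pow, hsq, hsq]

/-- Young's inequality `L¹ * L² → L²` for nonnegative functions. -/
theorem lintegral_lintegral_mul_sub_sq_le {E : Type*} [AddGroup E] [MeasurableSpace E]
    [MeasurableAdd₂ E] [MeasurableNeg E] {μ : Measure E} [SFinite μ] [μ.IsAddRightInvariant]
    {f u : E → ℝ≥0∞} (hf : Measurable f) (hu : Measurable u) :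
    ∫⁻ x, (∫⁻ y, f y * u (x - y) ∂μ) ^ 2 ∂μ ≤ (∫⁻ y, f y ∂μ) ^ 2 * ∫⁻ z, u z ^ 2 ∂μ := by
  have hxy : Measurable fun p : E × E => f p.2 * u (p.1 - p.2) ^ 2 := by fun_prop
  calc ∫⁻ x, (∫⁻ y, f y * u (x - y) ∂μ) ^ 2 ∂μ
      ≤ ∫⁻ x, (∫⁻ y, f y ∂μ) * ∫⁻ y, f y * u (x - y) ^ 2 ∂μ ∂μ := by
        gcongr with x
        exact lintegral_mul_sq_le hf.aemeasurable (by fun_prop)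
    _ = (∫⁻ y, f y ∂μ) * ∫⁻ y, ∫⁻ x, f y * u (x - y) ^ 2 ∂μ ∂μ := by
        rw [lintegral_const_mul _ hxy.lintegral_prod_right', lintegral_lintegral_swap]
        exact hxy.aemeasurable
    _ = (∫⁻ y, f y ∂μ) * ∫⁻ y, f y * ∫⁻ z, u z ^ 2 ∂μ ∂μ := by
        congr 2 with y
        rw [lintegral_const_mul _ (by fun_prop),
          lintegral_sub_right_eq_self (fun z => u z ^ 2) y]
    _ = _ := by rw [lintegral_mul_const _ hf]; ring

theorem stmt_11 {k : ℕ} (V Vt : Set (EuclideanSpace ℝ (Fin k)))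
    (hVcl : IsClosed V) (hVcone : IsConeSet V)
    (hVtcl : IsClosed Vt) (hVtcone : IsConeSet Vt)
    (hsub : V \ {0} ⊆ interior Vt) (r s : ℝ) :
    ∃ C : ℝ, 0 < C ∧
      ∀ g h : EuclideanSpace ℝ (Fin k) → ℝ≥0∞, Measurable g → Measurable h →
        (∫⁻ x in V, ENNReal.ofReal (jb x ^ (2 * r)) * (∫⁻ y, g y * h (x - y)) ^ 2) ^ (1 / 2 : ℝ)
          ≤ ENNReal.ofReal C
            * (∫⁻ y, ENNReal.ofReal (jb y ^ (3 * |r| + 2 * |s|)) * g y)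
            * ((∫⁻ z in Vt, ENNReal.ofReal (jb z ^ (2 * r)) * (h z) ^ 2) ^ (1 / 2 : ℝ)
              + (∫⁻ z, ENNReal.ofReal (jb z ^ (2 * s)) * (h z) ^ 2) ^ (1 / 2 : ℝ)) := by
  obtain ⟨C, hC, hbd⟩ := exists_jb_rpow_le hVcl hVcone hVtcone hsub r s
  refine ⟨C, hC, fun g h hg hh => ?_⟩
  have hjb (t : ℝ) : Measurable fun x : EuclideanSpace ℝ (Fin k) => ENNReal.ofReal (jb x ^ t) :=
    (continuous_jb.measurable.pow_const t).ennreal_ofReal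
  have hjb2 (t : ℝ) (x : EuclideanSpace ℝ (Fin k)) :
      ENNReal.ofReal (jb x ^ (2 * t)) = ENNReal.ofReal (jb x ^ t) ^ 2 := by
    have := one_le_jb x
    rw [← ENNReal.ofReal_pow (by positivity), ← Real.rpow_mul_natCast (by positivity)]
    congr 2
    push_cast
    ring
  set G : EuclideanSpace ℝ (Fin k) → ℝ≥0∞ := fun y =>
    ENNReal.ofReal C * (ENNReal.ofReal (jb y ^ (3 * |r| + 2 * |s|)) * g y) with hG
  set F₁ : EuclideanSpace ℝ (Fin k) → ℝ≥0∞ :=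
    Vt.indicator fun z => ENNReal.ofReal (jb z ^ r) * h z with hF₁
  set F₂ : EuclideanSpace ℝ (Fin k) → ℝ≥0∞ := fun z => ENNReal.ofReal (jb z ^ s) * h z with hF₂
  have hGm : Measurable G := ((hjb _).mul hg).const_mul _
  have hF₁m : Measurable F₁ := ((hjb _).mul hh).indicator hVtcl.measurableSet
  have hF₂m : Measurable F₂ := (hjb _).mul hh
  have hGint : ∫⁻ y, G y =
      ENNReal.ofReal C * ∫⁻ y, ENNReal.ofReal (jb y ^ (3 * |r| + 2 * |s|)) * g y :=
    lintegral_const_mul _ ((hjb _).mul hg)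
  have hF₁int : ∫⁻ z, F₁ z ^ 2 = ∫⁻ z in Vt, ENNReal.ofReal (jb z ^ (2 * r)) * h z ^ 2 := by
    rw [← lintegral_indicator hVtcl.measurableSet]
    congr 1 with z
    by_cases hz : z ∈ Vt <;> simp [hF₁, hz, hjb2, mul_pow]
  have hF₂int : ∫⁻ z, F₂ z ^ 2 = ∫⁻ z, ENNReal.ofReal (jb z ^ (2 * s)) * h z ^ 2 := by
    simp only [hF₂, hjb2, mul_pow]
  have hpt : ∀ x ∈ V, ∀ y,
      ENNReal.ofReal (jb x ^ r) * (g y * h (x - y)) ≤ G y * (F₁ + F₂) (x - y) := by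
    intro x hx y
    have hy := one_le_jb y
    have key (t : ℝ)
        (ht : jb x ^ r ≤ C * jb y ^ (3 * |r| + 2 * |s|) * jb (x - y) ^ t) :
        ENNReal.ofReal (jb x ^ r) * (g y * h (x - y)) ≤
          G y * (ENNReal.ofReal (jb (x - y) ^ t) * h (x - y)) := by
      calc _ ≤ ENNReal.ofReal (C * jb y ^ (3 * |r| + 2 * |s|) * jb (x - y) ^ t) *
            (g y * h (x - y)) := by gcongr
        _ = _ := by
          rw [ENNReal.ofReal_mul (by positivity), ENNReal.ofReal_mul hC.le]
          ring
    by_cases hz : x - y ∈ Vt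
    · refine (key r ((hbd x hx y).1 hz)).trans ?_
      gcongr
      simp [hF₁, hz]
    · refine (key s ((hbd x hx y).2 hz)).trans ?_
      gcongr
      simp [hF₂]
  have hconv : ∫⁻ x in V, ENNReal.ofReal (jb x ^ (2 * r)) * (∫⁻ y, g y * h (x - y)) ^ 2 ≤
      (∫⁻ y, G y) ^ 2 * ∫⁻ z, (F₁ + F₂) z ^ 2 := by
    calc _ ≤ ∫⁻ x in V, (∫⁻ y, G y * (F₁ + F₂) (x - y)) ^ 2 := by
          refine setLIntegral_mono' hVcl.measurableSet fun x hx => ?_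
          rw [hjb2, ← mul_pow, ← lintegral_const_mul' _ _ ENNReal.ofReal_ne_top]
          gcongr ?_ ^ 2
          exact lintegral_mono fun y => hpt x hx y
      _ ≤ ∫⁻ x, (∫⁻ y, G y * (F₁ + F₂) (x - y)) ^ 2 := setLIntegral_le_lintegral _ _
      _ ≤ _ := lintegral_lintegral_mul_sub_sq_le hGm (hF₁m.add hF₂m)
  have hadd := ENNReal.lintegral_Lp_add_le (μ := volume) hF₁m.aemeasurable hF₂m.aemeasurable
    one_le_two
  simp only [ENNReal.rpow_two] at hadd
  rw [← hGint, ← hF₁int, ← hF₂int]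
  calc _ ≤ ((∫⁻ y, G y) ^ 2 * ∫⁻ z, (F₁ + F₂) z ^ 2) ^ (1 / 2 : ℝ) := by gcongr
    _ = (∫⁻ y, G y) * (∫⁻ z, (F₁ + F₂) z ^ 2) ^ (1 / 2 : ℝ) := by
      rw [ENNReal.mul_rpow_of_nonneg _ _ (by norm_num), ← ENNReal.rpow_natCast_mul]
      norm_num
    _ ≤ _ := by gcongr
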